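/- arXiv:1710.07523 — 2 statements merged into one kernel-verified Lean document; each statement's English description precedes it below -/
import Mathlib

section
/- Let C = xC₁ + yC₂ + xyC₃ + yxC₄ and D = xD₁ + yD₂ + xyD₃ + yxD₄ be r×r matrices over B, where the Cᵢ and Dᵢ are r×r matrices over k, and suppose ν(C)D = wI_r. Then for every row vector u ∈ Bʳ with ν(u)·D = 0 there exists a row vector v ∈ Bʳ with v·C = u. In other words, the kernel of the map u ↦ ν(u)D is contained in the image of the map v ↦ vC. -/
noncomputable section
open FreeAlgebra Matrix

/-- The defining relations of `B = k⟨x,y⟩/(x², y², xyx, yxy)`. -/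
inductive BRel (k : Type*) [Field k] : FreeAlgebra k (Fin 2) → FreeAlgebra k (Fin 2) → Prop
  | xx : BRel k (ι k 0 * ι k 0) 0
  | yy : BRel k (ι k 1 * ι k 1) 0
  | xyx : BRel k (ι k 0 * ι k 1 * ι k 0) 0
  | yxy : BRel k (ι k 1 * ι k 0 * ι k 1) 0

/-- The algebra `B = k⟨x,y⟩/(x², y², xyx, yxy)`. -/
abbrev B (k : Type*) [Field k] := RingQuot (BRel k)

/-- The image of the generator `x` in `B`. -/
def Bx (k : Type*) [Field k] : B k := RingQuot.mkAlgHom k (BRel k) (ι k 0)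

/-- The image of the generator `y` in `B`. -/
def By (k : Type*) [Field k] : B k := RingQuot.mkAlgHom k (BRel k) (ι k 1)

/-- The element `w = xy - q·yx` of `B`. -/
def wB (k : Type*) [Field k] (q : k) : B k := Bx k * By k - q • (By k * Bx k)

/-- Regard a matrix over `k` as a matrix over `B` via the structure map. -/
def matB (k : Type*) [Field k] {r : ℕ} (M : Matrix (Fin r) (Fin r) k) :
    Matrix (Fin r) (Fin r) (B k) :=
  M.map (algebraMap k (B k))

section NormalForm

variable {k : Type*} [Field k]

lemma Bx_mul_Bx : Bx k * Bx k = 0 := by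
  simpa [Bx] using RingQuot.mkAlgHom_rel k (BRel.xx (k := k))

lemma By_mul_By : By k * By k = 0 := by
  simpa [By] using RingQuot.mkAlgHom_rel k (BRel.yy (k := k))

lemma Bx_mul_By_mul_Bx : Bx k * (By k * Bx k) = 0 := by
  simpa [Bx, By, mul_assoc] using RingQuot.mkAlgHom_rel k (BRel.xyx (k := k))

lemma By_mul_Bx_mul_By : By k * (Bx k * By k) = 0 := by
  simpa [Bx, By, mul_assoc] using RingQuot.mkAlgHom_rel k (BRel.yxy (k := k))

/-- The element of `B` with coordinates `a, b, c, d, e` with respect to `1, x, y, xy, yx`. -/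
def normalForm (a b c d e : k) : B k :=
  a • (1 : B k) + b • Bx k + c • By k + d • (Bx k * By k) + e • (By k * Bx k)

lemma Bx_mul_Bx_mul (z : B k) : Bx k * (Bx k * z) = 0 := by
  rw [← mul_assoc, Bx_mul_Bx, zero_mul]

lemma By_mul_By_mul (z : B k) : By k * (By k * z) = 0 := by
  rw [← mul_assoc, By_mul_By, zero_mul]

lemma normalForm_mul (a b c d e a' b' c' d' e' : k) :
    normalForm a b c d e * normalForm a' b' c' d' e' =
      normalForm (a * a') (a * b' + b * a') (a * c' + c * a')
        (a * d' + d * a' + b * c') (a * e' + e * a' + c * b') := by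
  simp only [normalForm, mul_add, add_mul, smul_mul_assoc, mul_smul_comm, mul_one, one_mul,
    mul_assoc, Bx_mul_Bx, By_mul_By, Bx_mul_By_mul_Bx, By_mul_Bx_mul_By, Bx_mul_Bx_mul,
    By_mul_By_mul, smul_add, smul_zero, mul_zero, add_smul,
    smul_smul, mul_comm (G := k)]
  abel

lemma normalForm_add (a b c d e a' b' c' d' e' : k) :
    normalForm a b c d e + normalForm a' b' c' d' e' =
      normalForm (a + a') (b + b') (c + c') (d + d') (e + e') := by
  simp only [normalForm, add_smul]
  abel

lemma normalForm_zero : normalForm (0 : k) 0 0 0 0 = 0 := by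
  simp [normalForm]

lemma normalForm_sum {ι : Type*} (s : Finset ι) (a b c d e : ι → k) :
    ∑ i ∈ s, normalForm (a i) (b i) (c i) (d i) (e i) =
      normalForm (∑ i ∈ s, a i) (∑ i ∈ s, b i) (∑ i ∈ s, c i) (∑ i ∈ s, d i) (∑ i ∈ s, e i) := by
  simp only [normalForm, Finset.sum_add_distrib, Finset.sum_smul]

lemma exists_normalForm (z : B k) : ∃ a b c d e : k, z = normalForm a b c d e := by
  obtain ⟨z, rfl⟩ := RingQuot.mkAlgHom_surjective k (BRel k) z
  induction z using FreeAlgebra.induction with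
  | grade0 t => exact ⟨t, 0, 0, 0, 0, by simp [normalForm, Algebra.algebraMap_eq_smul_one]⟩
  | grade1 i =>
    fin_cases i
    · exact ⟨0, 1, 0, 0, 0, by simp [normalForm, Bx]⟩
    · exact ⟨0, 0, 1, 0, 0, by simp [normalForm, By]⟩
  | mul z z' h h' =>
    obtain ⟨a, b, c, d, e, h⟩ := h
    obtain ⟨a', b', c', d', e', h'⟩ := h'
    exact ⟨_, _, _, _, _, by rw [map_mul, h, h', normalForm_mul]⟩
  | add z z' h h' =>
    obtain ⟨a, b, c, d, e, h⟩ := h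
    obtain ⟨a', b', c', d', e', h'⟩ := h'
    exact ⟨_, _, _, _, _, by rw [map_add, h, h', normalForm_add]⟩

/-- A pair of matrices satisfying the relations of `B` defines a representation of `B`. -/
def liftB {A : Type*} [Ring A] [Algebra k A] (X Y : A) (hX : X * X = 0) (hY : Y * Y = 0)
    (hXYX : X * Y * X = 0) (hYXY : Y * X * Y = 0) : B k →ₐ[k] A :=
  RingQuot.liftAlgHom k ⟨FreeAlgebra.lift k ![X, Y], by
    intro _ _ h
    cases h <;> simpa⟩

lemma liftB_normalForm {A : Type*} [Ring A] [Algebra k A] (X Y : A) (hX : X * X = 0)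
    (hY : Y * Y = 0) (hXYX : X * Y * X = 0) (hYXY : Y * X * Y = 0) (a b c d e : k) :
    liftB X Y hX hY hXYX hYXY (normalForm a b c d e) =
      a • (1 : A) + b • X + c • Y + d • (X * Y) + e • (Y * X) := by
  simp [liftB, normalForm, Bx, By]

lemma normalForm_inj {a b c d e a' b' c' d' e' : k}
    (h : normalForm a b c d e = normalForm a' b' c' d' e') :
    a = a' ∧ b = b' ∧ c = c' ∧ d = d' ∧ e = e' := by
  let X : Matrix (Fin 3) (Fin 3) k := !![0, 1, 0; 0, 0, 0; 0, 0, 0]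
  let Y : Matrix (Fin 3) (Fin 3) k := !![0, 0, 0; 0, 0, 1; 0, 0, 0]
  have hX : X * X = 0 := by ext i j; fin_cases i <;> fin_cases j <;> simp [X]
  have hY : Y * Y = 0 := by ext i j; fin_cases i <;> fin_cases j <;> simp [Y]
  have hYX : Y * X = 0 := by ext i j; fin_cases i <;> fin_cases j <;> simp [X, Y]
  have hXYX : X * Y * X = 0 := by rw [mul_assoc, hYX, mul_zero]
  have hYXY : Y * X * Y = 0 := by rw [hYX, zero_mul]
  have h₁ := congrArg (liftB X Y hX hY hXYX hYXY) h
  have h₂ := congrArg (liftB Y X hY hX hYXY hXYX) h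
  rw [liftB_normalForm, liftB_normalForm] at h₁ h₂
  have h00 := congrFun₂ h₁ 0 0
  have h01 := congrFun₂ h₁ 0 1
  have h12 := congrFun₂ h₁ 1 2
  have h02 := congrFun₂ h₁ 0 2
  have h02' := congrFun₂ h₂ 0 2
  simp [X, Y] at h00 h01 h12 h02 h02'
  exact ⟨h00, h01, h12, h02, h02'⟩

lemma neg_smul_B (t : k) (z : B k) : (-t) • z = -(t • z) := neg_smul t z

lemma neg_mul_B (z z' : B k) : -z * z' = -(z * z') := neg_mul z z'

lemma mul_neg_B (z z' : B k) : z * -z' = -(z * z') := mul_neg z z'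

lemma map_normalForm {q : k} (hq : q ≠ 0) (ν : B k ≃ₐ[k] B k)
    (hνx : ν (Bx k) = -(q⁻¹ • Bx k)) (hνy : ν (By k) = -(q • By k)) (a b c d e : k) :
    ν (normalForm a b c d e) = normalForm a (-(q⁻¹ * b)) (-(q * c)) d e := by
  simp [normalForm, hνx, hνy, smul_smul, hq, mul_comm, neg_smul_B, neg_mul_B, mul_neg_B]

lemma wB_eq_normalForm (q : k) : wB k q = normalForm 0 0 0 1 (-q) := by
  simp [wB, normalForm, sub_eq_add_neg, neg_smul_B]

lemma combination_apply {r : ℕ} (M₁ M₂ M₃ M₄ : Matrix (Fin r) (Fin r) k) (i j : Fin r) :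
    (Bx k • matB k M₁ + By k • matB k M₂ + (Bx k * By k) • matB k M₃ +
      (By k * Bx k) • matB k M₄) i j = normalForm 0 (M₁ i j) (M₂ i j) (M₃ i j) (M₄ i j) := by
  simp [matB, normalForm, Algebra.algebraMap_eq_smul_one]

end NormalForm

theorem stmt10 (k : Type*) [Field k] (q : k) (hq : q ≠ 0)
    (ν : B k ≃ₐ[k] B k)
    (hνx : ν (Bx k) = -(q⁻¹ • Bx k)) (hνy : ν (By k) = -(q • By k))
    (r : ℕ) (C1 C2 C3 C4 D1 D2 D3 D4 : Matrix (Fin r) (Fin r) k)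
    (C D : Matrix (Fin r) (Fin r) (B k))
    (hC : C = Bx k • matB k C1 + By k • matB k C2 +
        (Bx k * By k) • matB k C3 + (By k * Bx k) • matB k C4)
    (hD : D = Bx k • matB k D1 + By k • matB k D2 +
        (Bx k * By k) • matB k D3 + (By k * Bx k) • matB k D4)
    (hfact : C.map ⇑ν * D = wB k q • (1 : Matrix (Fin r) (Fin r) (B k))) :
    ∀ u : Fin r → B k, (fun i => ν (u i)) ᵥ* D = 0 →
      ∃ v : Fin r → B k, v ᵥ* C = u := by
  have hC' (i j) : C i j = normalForm 0 (C1 i j) (C2 i j) (C3 i j) (C4 i j) := by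
    rw [hC, combination_apply]
  have hD' (i j) : D i j = normalForm 0 (D1 i j) (D2 i j) (D3 i j) (D4 i j) := by
    rw [hD, combination_apply]
  have hcoeff (i j) := congrFun₂ hfact i j
  simp only [Matrix.mul_apply, Matrix.map_apply, hC', hD', map_normalForm hq ν hνx hνy,
    normalForm_mul, normalForm_sum, Matrix.smul_apply, wB_eq_normalForm] at hcoeff
  have hw (i j) : normalForm 0 0 0 1 (-q) • (1 : Matrix (Fin r) (Fin r) (B k)) i j =
      normalForm 0 0 0 ((1 : Matrix (Fin r) (Fin r) k) i j)
        (-q * (1 : Matrix (Fin r) (Fin r) k) i j) := by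
    obtain rfl | hij := eq_or_ne i j
    · simp
    · simp [Matrix.one_apply_ne hij, normalForm_zero]
  have hCD (i j) := normalForm_inj ((hcoeff i j).trans (hw i j))
  have h₁₂ : C1 * (-q⁻¹ • D2) = 1 := by
    ext i j
    simpa [Matrix.mul_apply, Finset.mul_sum, mul_comm, mul_assoc, mul_left_comm] using
      (hCD i j).2.2.2.1
  have h₂₁ : C2 * D1 = 1 := by
    ext i j
    have h := (hCD i j).2.2.2.2
    simp only [zero_mul, mul_zero, zero_add, neg_mul, Finset.sum_neg_distrib, mul_assoc,
      ← Finset.mul_sum, neg_inj] at h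
    simpa [Matrix.mul_apply] using mul_left_cancel₀ hq h
  have h₁₂' : D2 * (-q⁻¹ • C1) = 1 := by
    simpa using mul_eq_one_comm.mp h₁₂
  have h₂₁' : D1 * C2 = 1 := mul_eq_one_comm.mp h₂₁
  intro u hu
  choose a b c d e hu' using fun i => exists_normalForm (u i)
  have hzero (j) := congrFun hu j
  simp only [Matrix.vecMul, dotProduct, hu', hD', map_normalForm hq ν hνx hνy,
    normalForm_mul, normalForm_sum, Pi.zero_apply, ← normalForm_zero] at hzero
  have hz (j) := normalForm_inj (hzero j)
  have ha : a = 0 := by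
    have : a ᵥ* D1 = 0 := by
      ext j
      simpa [Matrix.vecMul, dotProduct] using (hz j).2.1
    simpa [Matrix.vecMul_vecMul, h₂₁'] using congrArg (· ᵥ* C2) this
  have hb : b = 0 := by
    have : b ᵥ* D2 = 0 := by
      ext j
      simpa [Matrix.vecMul, dotProduct, ha, mul_assoc, ← Finset.mul_sum, hq] using (hz j).2.2.2.1
    have h := congrArg (· ᵥ* (-q⁻¹ • C1)) this
    simp only [Matrix.vecMul_vecMul, h₁₂', Matrix.vecMul_one, Matrix.zero_vecMul] at h
    exact h
  have hc : c = 0 := by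
    have : c ᵥ* D1 = 0 := by
      ext j
      simpa [Matrix.vecMul, dotProduct, ha, mul_assoc, ← Finset.mul_sum, hq] using (hz j).2.2.2.2
    simpa [Matrix.vecMul_vecMul, h₂₁'] using congrArg (· ᵥ* C2) this
  have hd : (d ᵥ* D1) ᵥ* C2 = d := by rw [Matrix.vecMul_vecMul, h₂₁', Matrix.vecMul_one]
  have he : (e ᵥ* (-q⁻¹ • D2)) ᵥ* C1 = e := by
    rw [Matrix.vecMul_vecMul, mul_eq_one_comm.mp h₁₂, Matrix.vecMul_one]
  refine ⟨fun i => normalForm 0 ((d ᵥ* D1) i) ((e ᵥ* (-q⁻¹ • D2)) i) 0 0, ?_⟩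
  ext j
  have hdj := congrFun hd j
  have hej := congrFun he j
  rw [Matrix.vecMul, dotProduct] at hdj hej
  simp only [Matrix.vecMul.eq_1 _ C, dotProduct, hC', normalForm_mul, normalForm_sum, hu' j]
  simp only [zero_mul, mul_zero, zero_add, Finset.sum_const_zero, hdj, hej, ha, hb, hc,
    Pi.zero_apply]
end
end

section
/- Let C₁ and C₂ be invertible r×r matrices over k, and set C = xC₁ + yC₂ and D = xC₂⁻¹ − qyC₁⁻¹, viewed as r×r matrices over B. Then ν(C)·D = wI_r and D·C = wI_r. Hence (Bʳ, Bʳ, ·C, ·D) is a twisted matrix factorization of w over B with respect to ν. -/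
noncomputable section
open FreeAlgebra Matrix

theorem Bx_mul_self (k : Type*) [Field k] : Bx k * Bx k = 0 := by
  simpa [Bx] using RingQuot.mkAlgHom_rel k (BRel.xx (k := k))

theorem By_mul_self (k : Type*) [Field k] : By k * By k = 0 := by
  simpa [By] using RingQuot.mkAlgHom_rel k (BRel.yy (k := k))

section

variable {k A n : Type*} [Field k] [Ring A] [Algebra k A]

theorem map_smul_map_algebraMap_add (ν : A ≃ₐ[k] A) (a b : A) (M N : Matrix n n k) :
    (a • M.map (algebraMap k A) + b • N.map (algebraMap k A)).map ⇑ν =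
      ν a • M.map (algebraMap k A) + ν b • N.map (algebraMap k A) := by
  ext i j
  simp

variable [Fintype n]

theorem smul_map_algebraMap_mul_smul_map_algebraMap (a b : A) (M N : Matrix n n k) :
    (a • M.map (algebraMap k A)) * (b • N.map (algebraMap k A)) =
      (a * b) • (M * N).map (algebraMap k A) := by
  ext i j
  simp only [Matrix.mul_apply, Matrix.smul_apply, Matrix.map_apply, smul_eq_mul, map_sum,
    map_mul, Finset.mul_sum]
  refine Finset.sum_congr rfl fun l _ => ?_
  rw [mul_assoc, ← mul_assoc (algebraMap k A (M i l)), Algebra.commutes (M i l) b]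
  simp only [mul_assoc]

/-- The product of two linear matrix pencils in square-zero elements `x`, `y`, where the
coefficients of the mixed terms multiply to the identity. -/
theorem linear_pencil_mul [DecidableEq n] {x y : A} (hx : x * x = 0) (hy : y * y = 0)
    (a b c d : k) {M N M' N' : Matrix n n k} (hM : M * M' = 1) (hN : N * N' = 1) :
    ((a • x) • M.map (algebraMap k A) + (b • y) • N.map (algebraMap k A)) *
        ((c • x) • N'.map (algebraMap k A) + (d • y) • M'.map (algebraMap k A)) =
      ((a * d) • (x * y) + (b * c) • (y * x)) • (1 : Matrix n n A) := by
  have h_one : (1 : Matrix n n k).map (algebraMap k A) = 1 :=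
    Matrix.map_one _ (map_zero _) (map_one _)
  rw [add_mul, mul_add, mul_add]
  simp only [smul_map_algebraMap_mul_smul_map_algebraMap, hM, hN, h_one, smul_mul_smul_comm,
    hx, hy, smul_zero, zero_smul, add_smul, zero_add, add_zero]

/-- The factorization of `x * y - q • (y * x)` by linear matrices in any `k`-algebra with
square-zero elements `x`, `y`. -/
theorem twisted_factorization [DecidableEq n] {x y : A} (hx : x * x = 0) (hy : y * y = 0)
    {q : k} (hq : q ≠ 0) (ν : A ≃ₐ[k] A) (hνx : ν x = -(q⁻¹ • x)) (hνy : ν y = -(q • y))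
    {C1 C2 : Matrix n n k} (h1 : IsUnit C1) (h2 : IsUnit C2) :
    (x • C1.map (algebraMap k A) + y • C2.map (algebraMap k A)).map ⇑ν *
        (x • C2⁻¹.map (algebraMap k A) - (q • y) • C1⁻¹.map (algebraMap k A)) =
      (x * y - q • (y * x)) • (1 : Matrix n n A) ∧
    (x • C2⁻¹.map (algebraMap k A) - (q • y) • C1⁻¹.map (algebraMap k A)) *
        (x • C1.map (algebraMap k A) + y • C2.map (algebraMap k A)) =
      (x * y - q • (y * x)) • (1 : Matrix n n A) := by
  rw [Matrix.isUnit_iff_isUnit_det] at h1 h2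
  constructor
  · rw [map_smul_map_algebraMap_add, hνx, hνy]
    simpa [hq, sub_eq_add_neg] using linear_pencil_mul hx hy (-q⁻¹) (-q) 1 (-q)
      (C1.mul_nonsing_inv h1) (C2.mul_nonsing_inv h2)
  · simpa [sub_eq_add_neg] using linear_pencil_mul hx hy 1 (-q) 1 1
      (C2.nonsing_inv_mul h2) (C1.nonsing_inv_mul h1)

end

theorem stmt12 (k : Type*) [Field k] (q : k) (hq : q ≠ 0)
    (ν : B k ≃ₐ[k] B k)
    (hνx : ν (Bx k) = -(q⁻¹ • Bx k)) (hνy : ν (By k) = -(q • By k))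
    (r : ℕ) (C1 C2 : Matrix (Fin r) (Fin r) k)
    (h1 : IsUnit C1) (h2 : IsUnit C2) :
    (Bx k • matB k C1 + By k • matB k C2).map ⇑ν *
        (Bx k • matB k C2⁻¹ - (q • By k) • matB k C1⁻¹) =
      wB k q • (1 : Matrix (Fin r) (Fin r) (B k)) ∧
    (Bx k • matB k C2⁻¹ - (q • By k) • matB k C1⁻¹) *
        (Bx k • matB k C1 + By k • matB k C2) =
      wB k q • (1 : Matrix (Fin r) (Fin r) (B k)) := by
  exact twisted_factorization (Bx_mul_self k) (By_mul_self k) hq ν hνx hνy h1 h2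
end
end
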